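/- Let q = 2^n, let B be a k-subset of GF(q), and let E be a subset of GF(q) such that f̂_B(μ) = f̂_E(μ^d) for all μ ∈ GF(q), where d is a positive integer with gcd(d, q−1) = 1. Let a, b ∈ GF(q)*. Then Σ_{x,y ∈ GF(q)} (−1)^{f_B(x) + f_B(y) + f_B(ax+by)} = q² − 6qk + 12k² − 8·N_E(a^d, b^d, 1). In particular, N_B(a, b, 1) = N_E(a^d, b^d, 1). -/

import Mathlib

open Finset

noncomputable instance (n : ℕ) : Fintype (GaloisField 2 n) := Fintype.ofFinite _

/-- The absolute trace map from `GF(2^n)` to `GF(2)`. -/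
noncomputable def Tr (n : ℕ) (x : GaloisField 2 n) : ZMod 2 :=
  Algebra.trace (ZMod 2) (GaloisField 2 n) x

/-- The characteristic function of a subset `B ⊆ GF(2^n)`. -/
noncomputable def charFun {n : ℕ} (B : Set (GaloisField 2 n)) (x : GaloisField 2 n) : ZMod 2 :=
  open scoped Classical in if x ∈ B then 1 else 0

/-- The Walsh transform of a Boolean function on `GF(2^n)`, as an integer. -/
noncomputable def walsh {n : ℕ} (f : GaloisField 2 n → ZMod 2) (μ : GaloisField 2 n) : ℤ :=
  ∑ x : GaloisField 2 n, (-1 : ℤ) ^ (f x + Tr n (μ * x)).val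

/-- The orbit of a base block `B ⊆ GF(2^n)` under the general affine group `GA₁(2^n)`,
i.e. the set of all blocks `aB + b` with `a ≠ 0`. -/
def affOrbit {n : ℕ} (B : Set (GaloisField 2 n)) : Set (Set (GaloisField 2 n)) :=
  {S | ∃ a b : GaloisField 2 n, a ≠ 0 ∧ S = (fun x => a * x + b) '' B}

/-- `N_E(a,b,c)`: the number of triples `(x,y,z) ∈ E³` with `ax + by + cz = 0`. -/
noncomputable def NE {n : ℕ} (E : Set (GaloisField 2 n)) (a b c : GaloisField 2 n) : ℕ :=
  Nat.card {t : GaloisField 2 n × GaloisField 2 n × GaloisField 2 n //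
    t.1 ∈ E ∧ t.2.1 ∈ E ∧ t.2.2 ∈ E ∧ a * t.1 + b * t.2.1 + c * t.2.2 = 0}

/-- `I_B(u₁,u₂,u₃)`: the number of pairs `(x,y) ∈ GF(2^n)²` with `uᵢ x + y ∈ B` for `i = 1,2,3`. -/
noncomputable def IB {n : ℕ} (B : Set (GaloisField 2 n)) (u₁ u₂ u₃ : GaloisField 2 n) : ℕ :=
  Nat.card {p : GaloisField 2 n × GaloisField 2 n //
    u₁ * p.1 + p.2 ∈ B ∧ u₂ * p.1 + p.2 ∈ B ∧ u₃ * p.1 + p.2 ∈ B}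

/-- The incidence structure `(GF(2^n), affOrbit B)` is a 3-design: there is a `λ` such that
every 3-subset of points lies in exactly `λ` blocks of the orbit. -/
def Is3Design {n : ℕ} (B : Set (GaloisField 2 n)) : Prop :=
  ∃ lam : ℕ, ∀ u v w : GaloisField 2 n, u ≠ v → u ≠ w → v ≠ w →
    Nat.card {S : Set (GaloisField 2 n) // S ∈ affOrbit B ∧ u ∈ S ∧ v ∈ S ∧ w ∈ S} = lam

lemma neg_one_pow_val_add (u v : ZMod 2) :
    (-1 : ℤ) ^ (u + v).val = (-1) ^ u.val * (-1) ^ v.val := by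
  revert u v; decide

/-- The integer-valued additive character `x ↦ (-1)^Tr(x)` of `GF(2^n)`. -/
noncomputable def traceChar (n : ℕ) : AddChar (GaloisField 2 n) ℤ where
  toFun x := (-1) ^ (Tr n x).val
  map_zero_eq_one' := by simp [Tr]
  map_add_eq_mul' x y := by
    simp only [Tr, map_add, neg_one_pow_val_add]

lemma traceChar_isPrimitive (n : ℕ) : (traceChar n).IsPrimitive := by
  refine AddChar.IsPrimitive.of_ne_one (AddChar.ne_one_iff.2 ?_)
  obtain ⟨c, hc⟩ := Algebra.trace_surjective (ZMod 2) (GaloisField 2 n) 1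
  refine ⟨c, ?_⟩
  change (-1 : ℤ) ^ (Tr n c).val ≠ 1
  rw [Tr, hc]
  decide

/-- The integer-valued indicator function of a subset of `GF(2^n)`. -/
noncomputable def intIndicator {n : ℕ} (E : Set (GaloisField 2 n)) : GaloisField 2 n → ℤ :=
  E.indicator 1

/-- The character sum of `traceChar` over a subset of `GF(2^n)`. -/
noncomputable def charSum {n : ℕ} (E : Set (GaloisField 2 n)) (μ : GaloisField 2 n) : ℤ :=
  ∑ x, intIndicator E x * traceChar n (μ * x)

lemma neg_one_pow_charFun {n : ℕ} (B : Set (GaloisField 2 n)) (x : GaloisField 2 n) :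
    (-1 : ℤ) ^ (charFun B x).val = 1 - 2 * intIndicator B x := by
  by_cases h : x ∈ B <;> simp [charFun, intIndicator, h, ZMod.val_one]

lemma card_galoisField_two {n : ℕ} (hn : 0 < n) : Fintype.card (GaloisField 2 n) = 2 ^ n := by
  rw [← Nat.card_eq_fintype_card, GaloisField.card 2 n hn.ne']

lemma sum_traceChar_mul {n : ℕ} (hn : 0 < n) (x : GaloisField 2 n) [Decidable (x = 0)] :
    ∑ μ, traceChar n (μ * x) = if x = 0 then (2 : ℤ) ^ n else 0 := by
  classical
  rw [AddChar.sum_mulShift x (traceChar_isPrimitive n), card_galoisField_two hn]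
  split_ifs <;> simp

lemma walsh_charFun {n : ℕ} (hn : 0 < n) (B : Set (GaloisField 2 n)) (μ : GaloisField 2 n)
    [Decidable (μ = 0)] :
    walsh (charFun B) μ = (if μ = 0 then (2 : ℤ) ^ n else 0) - 2 * charSum B μ := by
  have h : ∀ x, (-1 : ℤ) ^ (charFun B x + Tr n (μ * x)).val =
      traceChar n (x * μ) - 2 * (intIndicator B x * traceChar n (μ * x)) := fun x => by
    rw [neg_one_pow_val_add, neg_one_pow_charFun, mul_comm x μ]
    change _ * traceChar n (μ * x) = _
    ring
  simp only [walsh, h, sum_sub_distrib, ← mul_sum, sum_traceChar_mul hn, charSum]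

lemma cast_NE {n : ℕ} [DecidableEq (GaloisField 2 n)] (E : Set (GaloisField 2 n))
    (a b c : GaloisField 2 n) :
    (NE E a b c : ℤ) = ∑ x, ∑ y, ∑ z, intIndicator E x * intIndicator E y * intIndicator E z *
      if a * x + b * y + c * z = 0 then 1 else 0 := by
  classical
  rw [NE, Nat.card_eq_fintype_card, Fintype.card_subtype, card_filter]
  push_cast
  rw [Fintype.sum_prod_type]
  refine sum_congr rfl fun x _ => ?_
  rw [Fintype.sum_prod_type]
  refine sum_congr rfl fun y _ => sum_congr rfl fun z _ => ?_
  by_cases hx : x ∈ E <;> by_cases hy : y ∈ E <;> by_cases hz : z ∈ E <;>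
    simp [intIndicator, hx, hy, hz]

lemma two_pow_mul_NE {n : ℕ} (hn : 0 < n) (E : Set (GaloisField 2 n)) (a b c : GaloisField 2 n) :
    (2 : ℤ) ^ n * NE E a b c =
      ∑ μ, charSum E (μ * a) * charSum E (μ * b) * charSum E (μ * c) := by
  classical
  have h : ∀ x : GaloisField 2 n, (2 : ℤ) ^ n * (if x = 0 then 1 else 0) =
      ∑ μ, traceChar n (μ * x) := fun x => by simp [sum_traceChar_mul hn]
  have hprod : ∀ μ, charSum E (μ * a) * charSum E (μ * b) * charSum E (μ * c) =
      ∑ x, ∑ y, ∑ z, intIndicator E x * intIndicator E y * intIndicator E z *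
        traceChar n (μ * (a * x + b * y + c * z)) := fun μ => by
    simp only [charSum]
    rw [sum_mul_sum, sum_mul]
    refine sum_congr rfl fun x _ => ?_
    rw [sum_mul_sum]
    refine sum_congr rfl fun y _ => sum_congr rfl fun z _ => ?_
    simp only [mul_add, AddChar.map_add_eq_mul, mul_assoc μ]
    ring
  simp only [cast_NE, hprod]
  rw [mul_sum, sum_comm]
  refine sum_congr rfl fun x _ => ?_
  rw [mul_sum, sum_comm]
  refine sum_congr rfl fun y _ => ?_
  rw [mul_sum, sum_comm]
  refine sum_congr rfl fun z _ => ?_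
  rw [mul_left_comm, h, mul_sum]

lemma sum_intIndicator {n : ℕ} (B : Set (GaloisField 2 n)) :
    ∑ x, intIndicator B x = B.ncard := by
  classical
  rw [Set.ncard_eq_toFinset_card', ← Set.filter_mem_univ_eq_toFinset]
  simp [intIndicator, Set.indicator_apply]

lemma sum_intIndicator_mul_add {n : ℕ} (B : Set (GaloisField 2 n)) {b : GaloisField 2 n}
    (hb : b ≠ 0) (c : GaloisField 2 n) :
    ∑ y, intIndicator B (c + b * y) = B.ncard := by
  rw [← sum_intIndicator]
  exact ((Equiv.mulLeft₀ b hb).trans (Equiv.addLeft c)).sum_comp (intIndicator B)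

lemma sum_neg_one_pow_charFun {n : ℕ} (hn : 0 < n) (B : Set (GaloisField 2 n))
    {a b : GaloisField 2 n} (ha : a ≠ 0) (hb : b ≠ 0) :
    (∑ x : GaloisField 2 n, ∑ y : GaloisField 2 n,
        (-1 : ℤ) ^ (charFun B x + charFun B y + charFun B (a * x + b * y)).val)
      = (2 ^ n : ℤ) ^ 2 - 6 * 2 ^ n * B.ncard + 12 * (B.ncard : ℤ) ^ 2 - 8 * NE B a b 1 := by
  classical
  have hN : (NE B a b 1 : ℤ) = ∑ x, ∑ y,
      intIndicator B x * intIndicator B y * intIndicator B (a * x + b * y) := by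
    rw [cast_NE]
    refine sum_congr rfl fun x _ => sum_congr rfl fun y _ => ?_
    simp only [one_mul, CharTwo.add_eq_zero]
    simp
  have h1 : ∑ x, ∑ y, intIndicator B x * intIndicator B (a * x + b * y) = (B.ncard : ℤ) ^ 2 := by
    simp only [← mul_sum, sum_intIndicator_mul_add B hb, ← sum_mul, sum_intIndicator, sq]
  have h2 : ∑ x, ∑ y, intIndicator B y * intIndicator B (a * x + b * y) = (B.ncard : ℤ) ^ 2 := by
    rw [sum_comm]
    simp only [add_comm (a * _), ← mul_sum, sum_intIndicator_mul_add B ha, ← sum_mul,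
      sum_intIndicator, sq]
  have h3 : ∑ x, ∑ y, intIndicator B x * intIndicator B y = (B.ncard : ℤ) ^ 2 := by
    simp only [← mul_sum, ← sum_mul, sum_intIndicator, sq]
  have h4 : ∑ x, ∑ y, intIndicator B (a * x + b * y) = (2 : ℤ) ^ n * B.ncard := by
    simp [sum_intIndicator_mul_add B hb, card_galoisField_two hn]
  have h5 : ∑ x : GaloisField 2 n, ∑ _y : GaloisField 2 n, intIndicator B x =
      (2 : ℤ) ^ n * B.ncard := by
    simp [← mul_sum, sum_intIndicator, card_galoisField_two hn]
  have h6 : ∑ _x : GaloisField 2 n, ∑ y : GaloisField 2 n, intIndicator B y =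
      (2 : ℤ) ^ n * B.ncard := by
    simp [sum_intIndicator, card_galoisField_two hn]
  have h7 : ∑ _x : GaloisField 2 n, ∑ _y : GaloisField 2 n, (1 : ℤ) = (2 ^ n) ^ 2 := by
    simp [card_galoisField_two hn, sq]
  have hexp : ∀ x y, (-1 : ℤ) ^ (charFun B x + charFun B y + charFun B (a * x + b * y)).val =
      1 - 2 * intIndicator B x - 2 * intIndicator B y - 2 * intIndicator B (a * x + b * y)
      + 4 * (intIndicator B x * intIndicator B y)
      + 4 * (intIndicator B x * intIndicator B (a * x + b * y))
      + 4 * (intIndicator B y * intIndicator B (a * x + b * y))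
      - 8 * (intIndicator B x * intIndicator B y * intIndicator B (a * x + b * y)) := fun x y => by
    simp only [neg_one_pow_val_add, neg_one_pow_charFun]
    ring
  simp only [hexp, sum_sub_distrib, sum_add_distrib, ← mul_sum (a := (2 : ℤ)),
    ← mul_sum (a := (4 : ℤ)), ← mul_sum (a := (8 : ℤ))]
  rw [hN, h1, h2, h3, h4, h5, h6, h7]
  ring

lemma pow_bijective_galoisField {n d : ℕ} (hn : 0 < n) (hd : 0 < d)
    (hgcd : Nat.gcd d (2 ^ n - 1) = 1) :
    Function.Bijective fun x : GaloisField 2 n => x ^ d := by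
  refine Finite.injective_iff_bijective.mp fun x y hxy => ?_
  change x ^ d = y ^ d at hxy
  rcases eq_or_ne x 0 with rfl | hx
  · rw [zero_pow hd.ne', eq_comm, pow_eq_zero_iff hd.ne'] at hxy
    exact hxy.symm
  rcases eq_or_ne y 0 with rfl | hy
  · rwa [zero_pow hd.ne', pow_eq_zero_iff hd.ne'] at hxy
  have hc : Nat.Coprime (Nat.card (GaloisField 2 n)ˣ) d := by
    rw [Nat.card_units, GaloisField.card 2 n hn.ne']
    exact Nat.Coprime.symm hgcd
  have := (powCoprime hc).injective (a₁ := Units.mk0 x hx) (a₂ := Units.mk0 y hy)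
    (Units.ext (by simpa using hxy))
  simpa using congrArg Units.val this

/-- Lemma 2.4: if the Walsh transform of `f_B` is that of `f_E` twisted by `μ ↦ μ^d`,
the triple sign sum for `B` is controlled by `N_E(a^d, b^d, 1)`;
in particular `N_B(a,b,1) = N_E(a^d,b^d,1)`. -/
theorem stmt_4 (n k d : ℕ) (hn : 0 < n) (hd : 0 < d) (hgcd : Nat.gcd d (2 ^ n - 1) = 1)
    (B E : Set (GaloisField 2 n)) (hB : B.ncard = k)
    (hBE : ∀ μ : GaloisField 2 n, walsh (charFun B) μ = walsh (charFun E) (μ ^ d))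
    (a b : GaloisField 2 n) (ha : a ≠ 0) (hb : b ≠ 0) :
    (∑ x : GaloisField 2 n, ∑ y : GaloisField 2 n,
        (-1 : ℤ) ^ (charFun B x + charFun B y + charFun B (a * x + b * y)).val)
      = (2 ^ n : ℤ) ^ 2 - 6 * 2 ^ n * k + 12 * (k : ℤ) ^ 2
          - 8 * (NE E (a ^ d) (b ^ d) 1 : ℤ) ∧
    NE B a b 1 = NE E (a ^ d) (b ^ d) 1 := by
  have hS : ∀ μ, charSum B μ = charSum E (μ ^ d) := fun μ => by
    classical
    have h := hBE μ
    simp only [walsh_charFun hn, pow_eq_zero_iff hd.ne'] at h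
    linarith
  have hNE : NE B a b 1 = NE E (a ^ d) (b ^ d) 1 := by
    have hq : (2 : ℤ) ^ n ≠ 0 := by positivity
    have h : (2 : ℤ) ^ n * NE B a b 1 = 2 ^ n * NE E (a ^ d) (b ^ d) 1 := by
      rw [two_pow_mul_NE hn, two_pow_mul_NE hn]
      simp only [hS, mul_pow, one_pow]
      exact (pow_bijective_galoisField hn hd hgcd).sum_comp fun μ =>
        charSum E (μ * a ^ d) * charSum E (μ * b ^ d) * charSum E (μ * 1)
    exact_mod_cast mul_left_cancel₀ hq h
  exact ⟨by rw [sum_neg_one_pow_charFun hn B ha hb, hB, hNE], hNE⟩
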